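/- arXiv:2601.17667 — 2 statements merged into one kernel-verified Lean document; each statement's English description precedes it below -/
import Mathlib

section
/- Consider a non-stationary K-armed bandit satisfying Assumption A2 with constants θ, ξ, η, run with the UCB-ERM algorithm with parameter α, where 1/2 ≤ η < 1, ξ > 1 is large enough that there exists α > 2 with ξη(1−η) ≤ α < ξ(1−η). Let ρ̄_n = (1/n) Σ_{i=1}^K T_i(n) ρ̂_{i,T_i(n)} be the empirical ERM_β under the algorithm. Then for all n ≥ K: |μ* − E[ρ̄_n]| ≤ n^{η−1}(1 + 2θ/(ξ−1)) + (1/n) · (2R + (exp(2βR) − 1)/β) · (K−1) · ((2θ^{1/ξ}/Δ_min)^{1/(1−η)} n^{α/(ξ(1−η))} + 2/(α−2) + 1). In particular |μ* − E[ρ̄_n]| = O(exp(2βR) n^{α/(ξ(1−η)) − 1}) and lim_{n→∞} E[ρ̄_n] = μ*. -/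
open MeasureTheory ProbabilityTheory Filter

/-- The empirical ERM_β estimator `ρ̂_n = (1/β) ln((1/n) Σ_{t<n} exp(β x_t))` (the sum runs
over the first `n` samples). -/
noncomputable def ermEst (β : ℝ) (n : ℕ) (x : ℕ → ℝ) : ℝ :=
  (1 / β) * Real.log ((1 / (n : ℝ)) * ∑ t ∈ Finset.range n, Real.exp (β * x t))

/-- The UCB exploration bonus `b_{t,s} = θ^{1/ξ} t^{α/ξ} / s^{1−η}`. -/
noncomputable def bonus (θ ξ η α : ℝ) (t s : ℕ) : ℝ :=
  θ ^ (1 / ξ) * (t : ℝ) ^ (α / ξ) / (s : ℝ) ^ (1 - η)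

/-- `pulls a i t ω` : the number of pulls `T_i(t)` of arm `i` up to and including round `t`
(rounds are indexed `1, 2, …`). -/
def pulls {Ω : Type*} {K : ℕ} (a : ℕ → Ω → Fin K) (i : Fin K) (t : ℕ) (ω : Ω) : ℕ :=
  ((Finset.Icc 1 t).filter fun s => a s ω = i).card

lemma mean_exp_mem_Icc {β R : ℝ} (hβ : 0 < β) {x : ℕ → ℝ} (hx : ∀ t, x t ∈ Set.Icc (-R) R)
    {n : ℕ} (hn : 1 ≤ n) :
    (1 / (n : ℝ)) * ∑ t ∈ Finset.range n, Real.exp (β * x t)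
      ∈ Set.Icc (Real.exp (-(β * R))) (Real.exp (β * R)) := by
  have hn0 : (0 : ℝ) < n := by exact_mod_cast hn
  have hlow : (n : ℝ) * Real.exp (-(β * R)) ≤ ∑ t ∈ Finset.range n, Real.exp (β * x t) := by
    have := Finset.card_nsmul_le_sum (Finset.range n) (fun t => Real.exp (β * x t))
      (Real.exp (-(β * R))) (fun t _ => Real.exp_le_exp.2 (by nlinarith [(hx t).1]))
    simpa using this
  have hup : ∑ t ∈ Finset.range n, Real.exp (β * x t) ≤ (n : ℝ) * Real.exp (β * R) := by
    have := Finset.sum_le_card_nsmul (Finset.range n) (fun t => Real.exp (β * x t))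
      (Real.exp (β * R)) (fun t _ => Real.exp_le_exp.2 (by nlinarith [(hx t).2]))
    simpa using this
  rw [one_div_mul_eq_div]
  exact ⟨(le_div_iff₀ hn0).2 (by linarith), (div_le_iff₀ hn0).2 (by linarith)⟩

lemma abs_ermEst_le {β R : ℝ} (hβ : 0 < β) (hR : 0 < R) {x : ℕ → ℝ}
    (hx : ∀ t, x t ∈ Set.Icc (-R) R) (n : ℕ) : |ermEst β n x| ≤ R := by
  rcases Nat.eq_zero_or_pos n with rfl | hn
  · simp [ermEst, hR.le]
  · obtain ⟨h1, h2⟩ := mean_exp_mem_Icc hβ hx hn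
    have hpos := (Real.exp_pos _).trans_le h1
    rw [← Real.le_log_iff_exp_le hpos] at h1
    rw [← Real.log_le_iff_le_exp hpos] at h2
    rw [ermEst, one_div_mul_eq_div, abs_le]
    exact ⟨(le_div_iff₀ hβ).2 (by linarith), (div_le_iff₀ hβ).2 (by linarith)⟩

lemma log_div_le_of_mul_abs_sub_le {A B L d s : ℝ} (hL : 0 < L) (hA : L ≤ A) (hB : L ≤ B)
    (hs : 0 ≤ s) (hd : s * |A - B| ≤ d) :
    s * |Real.log A - Real.log B| ≤ d / L := by
  have key : ∀ {A B : ℝ}, L ≤ A → L ≤ B → Real.log A - Real.log B ≤ |A - B| / L := by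
    intro A B hA hB
    have hA0 := hL.trans_le hA
    have hB0 := hL.trans_le hB
    calc Real.log A - Real.log B = Real.log (A / B) := (Real.log_div hA0.ne' hB0.ne').symm
      _ ≤ A / B - 1 := Real.log_le_sub_one_of_pos (by positivity)
      _ = (A - B) / B := by field_simp
      _ ≤ |A - B| / B := by gcongr; exact le_abs_self _
      _ ≤ |A - B| / L := by gcongr
  have h : |Real.log A - Real.log B| ≤ |A - B| / L := by
    rw [abs_le]
    have h1 := key hA hB
    have h2 := key hB hA
    rw [abs_sub_comm] at h2
    constructor <;> linarith
  calc s * |Real.log A - Real.log B| ≤ s * (|A - B| / L) := by gcongr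
    _ = s * |A - B| / L := by ring
    _ ≤ d / L := by gcongr

lemma mul_abs_ermEst_sub_le {β R : ℝ} (hβ : 0 < β) (hR : 0 < R) {x : ℕ → ℝ}
    (hx : ∀ t, x t ∈ Set.Icc (-R) R) {s n : ℕ} (hsn : s ≤ n) :
    (s : ℝ) * |ermEst β n x - ermEst β s x|
      ≤ ((n : ℝ) - s) * ((Real.exp (2 * β * R) - 1) / β) := by
  have hsn' : (s : ℝ) ≤ n := by exact_mod_cast hsn
  have hE : 0 ≤ (Real.exp (2 * β * R) - 1) / β :=
    div_nonneg (by linarith [Real.one_le_exp (by positivity : 0 ≤ 2 * β * R)]) hβ.le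
  rcases Nat.eq_zero_or_pos s with rfl | hs
  · simpa using mul_nonneg (Nat.cast_nonneg n) hE
  have hn : 1 ≤ n := Nat.le_trans hs hsn
  have hs0 : (0 : ℝ) < s := by exact_mod_cast hs
  have hn0 : (0 : ℝ) < n := by exact_mod_cast hn
  have hA := mean_exp_mem_Icc hβ hx hn
  have hB := mean_exp_mem_Icc hβ hx hs
  set L := Real.exp (-(β * R)) with hL
  set U := Real.exp (β * R) with hU
  set S := ∑ t ∈ Finset.range s, Real.exp (β * x t) with hS
  set D := ∑ t ∈ Finset.Ico s n, Real.exp (β * x t) with hD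
  have hsplit : ∑ t ∈ Finset.range n, Real.exp (β * x t) = S + D :=
    (Finset.sum_range_add_sum_Ico _ hsn).symm
  rw [hsplit] at hA
  have hDl : ((n : ℝ) - s) * L ≤ D := by
    have := Finset.card_nsmul_le_sum (Finset.Ico s n) (fun t => Real.exp (β * x t)) L
      (fun t _ => Real.exp_le_exp.2 (by nlinarith [(hx t).1]))
    simpa [Nat.cast_sub hsn] using this
  have hDu : D ≤ ((n : ℝ) - s) * U := by
    have := Finset.sum_le_card_nsmul (Finset.Ico s n) (fun t => Real.exp (β * x t)) U
      (fun t _ => Real.exp_le_exp.2 (by nlinarith [(hx t).2]))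
    simpa [Nat.cast_sub hsn] using this
  have hdiff : (1 / (n : ℝ)) * (S + D) - (1 / (s : ℝ)) * S
      = (D - (n - s) * ((1 / (s : ℝ)) * S)) / n := by
    field_simp
    ring
  have hLU : L ≤ U := Real.exp_le_exp.2 (by nlinarith [mul_pos hβ hR])
  have hmain : (s : ℝ) * |(1 / (n : ℝ)) * (S + D) - (1 / (s : ℝ)) * S| ≤ (n - s) * (U - L) := by
    have habs : |D - (n - s) * ((1 / (s : ℝ)) * S)| ≤ (n - s) * (U - L) := by
      rw [abs_le]
      have h1 := mul_le_mul_of_nonneg_left hB.1 (sub_nonneg.2 hsn')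
      have h2 := mul_le_mul_of_nonneg_left hB.2 (sub_nonneg.2 hsn')
      constructor <;> nlinarith
    rw [hdiff, abs_div, abs_of_pos hn0, mul_div_assoc', div_le_iff₀ hn0]
    have h0 : 0 ≤ (n - s) * (U - L) := mul_nonneg (by linarith) (by linarith)
    nlinarith [abs_nonneg (D - (n - s) * ((1 / (s : ℝ)) * S))]
  have hlog := log_div_le_of_mul_abs_sub_le (Real.exp_pos _) hA.1 hB.1 hs0.le hmain
  have hUL : (U - L) / L = Real.exp (2 * β * R) - 1 := by
    rw [sub_div, div_self (Real.exp_pos _).ne', hU, hL, ← Real.exp_sub]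
    ring_nf
  unfold ermEst
  rw [hsplit, ← mul_sub, abs_mul, abs_of_pos (by positivity : 0 < 1 / β), ← hUL]
  calc _ = (1 / β) * ((s : ℝ) * |Real.log ((1 / (n : ℝ)) * (S + D))
          - Real.log ((1 / (s : ℝ)) * S)|) := by ring
    _ ≤ (1 / β) * ((n - s) * (U - L) / L) := by gcongr
    _ = _ := by ring

lemma integral_le_one_add_of_tail_le {Ω : Type*} [MeasurableSpace Ω] {P : Measure Ω}
    [IsProbabilityMeasure P] {W : Ω → ℝ} (hW : Integrable W P) (hW0 : ∀ ω, 0 ≤ W ω)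
    {c ξ : ℝ} (hξ : 1 < ξ) (htail : ∀ z : ℝ, 1 ≤ z → P.real {ω | z ≤ W ω} ≤ c * z ^ (-ξ)) :
    ∫ ω, W ω ∂P ≤ 1 + c / (ξ - 1) := by
  rw [hW.integral_eq_integral_meas_le (.of_forall hW0)]
  set g : ℝ → ℝ := fun z => if z ≤ 1 then 1 else c * z ^ (-ξ) with hg
  have hg1 : Set.EqOn g (fun _ => 1) (Set.Ioc 0 1) := fun z hz => if_pos hz.2
  have hg2 : Set.EqOn g (fun z => c * z ^ (-ξ)) (Set.Ioi 1) :=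
    fun z hz => if_neg (not_le.2 hz)
  have hi1 : IntegrableOn g (Set.Ioc 0 1) :=
    (integrableOn_const (by simp)).congr_fun hg1.symm measurableSet_Ioc
  have hi2 : IntegrableOn g (Set.Ioi 1) :=
    IntegrableOn.congr_fun
      ((integrableOn_Ioi_rpow_of_lt (by linarith : -ξ < -1) one_pos).const_mul c) hg2.symm
      measurableSet_Ioi
  have hun : Set.Ioc (0 : ℝ) 1 ∪ Set.Ioi 1 = Set.Ioi 0 := Set.Ioc_union_Ioi_eq_Ioi zero_le_one
  calc ∫ t in Set.Ioi 0, P.real {a | t ≤ W a} ≤ ∫ t in Set.Ioi 0, g t := by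
        refine integral_mono_of_nonneg (.of_forall fun _ => measureReal_nonneg)
          (hun ▸ hi1.union hi2) (.of_forall fun z => ?_)
        by_cases hz : z ≤ 1
        · simp [hg, hz, measureReal_le_one]
        · simpa [hg, hz] using htail z (not_le.1 hz).le
    _ = 1 + c / (ξ - 1) := by
        rw [← hun, setIntegral_union (Set.Ioc_disjoint_Ioi le_rfl) measurableSet_Ioi hi1 hi2,
          setIntegral_congr_fun measurableSet_Ioc hg1, setIntegral_congr_fun measurableSet_Ioi hg2,
          integral_const_mul, integral_Ioi_rpow_of_lt (by linarith) one_pos]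
        have : ξ - 1 ≠ 0 := by linarith
        have h' : -ξ + 1 ≠ 0 := by linarith
        simp
        field_simp
        ring

lemma sum_Ico_add_one_rpow_le {α : ℝ} (hα : 2 < α) (n : ℕ) :
    ∑ t ∈ Finset.Ico 1 n, ((t + 1 : ℕ) : ℝ) ^ (1 - α) ≤ 1 / (α - 2) := by
  have hpos : 0 < α - 2 := by linarith
  set m := n - 1
  have hanti : AntitoneOn (fun y : ℝ => y ^ (1 - α)) (Set.Icc 1 (1 + (m : ℝ))) :=
    fun y hy z _ hyz => Real.rpow_le_rpow_of_nonpos (by linarith [hy.1]) hyz (by linarith)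
  have hsum := hanti.sum_le_integral
  have h0mem : (0 : ℝ) ∉ Set.uIcc 1 (1 + (m : ℝ)) := by
    rw [Set.uIcc_of_le (by simp)]
    exact fun h => by linarith [h.1]
  rw [integral_rpow (Or.inr ⟨by linarith, h0mem⟩)] at hsum
  have hre : ∑ t ∈ Finset.Ico 1 n, ((t + 1 : ℕ) : ℝ) ^ (1 - α)
      = ∑ i ∈ Finset.range m, (1 + ((i + 1 : ℕ) : ℝ)) ^ (1 - α) := by
    rw [Finset.sum_Ico_eq_sum_range]
    exact Finset.sum_congr rfl fun i _ => by push_cast; ring_nf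
  rw [hre]
  refine hsum.trans ?_
  have h0 : 0 ≤ (1 + (m : ℝ)) ^ (1 - α + 1) := by positivity
  rw [Real.one_rpow, ← neg_div_neg_eq, show -(1 - α + 1) = α - 2 by ring]
  gcongr
  linarith

lemma pulls_succ {Ω : Type*} {K : ℕ} (a : ℕ → Ω → Fin K) (i : Fin K) (n : ℕ) (ω : Ω) :
    pulls a i (n + 1) ω = pulls a i n ω + if a (n + 1) ω = i then 1 else 0 := by
  unfold pulls
  rw [← Finset.insert_Icc_right_eq_Icc_add_one (by omega), Finset.filter_insert]
  split_ifs with h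
  · rw [Finset.card_insert_of_notMem (by simp)]
  · rfl

lemma pulls_zero {Ω : Type*} {K : ℕ} (a : ℕ → Ω → Fin K) (i : Fin K) (ω : Ω) :
    pulls a i 0 ω = 0 := by
  simp [pulls]

lemma pulls_le {Ω : Type*} {K : ℕ} (a : ℕ → Ω → Fin K) (i : Fin K) (n : ℕ) (ω : Ω) :
    pulls a i n ω ≤ n := by
  simpa [pulls] using Finset.card_filter_le (Finset.Icc 1 n) fun s => a s ω = i

lemma sum_pulls {Ω : Type*} {K : ℕ} (a : ℕ → Ω → Fin K) (n : ℕ) (ω : Ω) :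
    ∑ i, pulls a i n ω = n := by
  unfold pulls
  rw [← Finset.card_eq_sum_card_fiberwise (fun _ _ => by simp)]
  simp

lemma measurable_pulls {Ω : Type*} [MeasurableSpace Ω] {K : ℕ} {a : ℕ → Ω → Fin K}
    (ha : ∀ t, Measurable (a t)) (i : Fin K) (n : ℕ) : Measurable (pulls a i n) := by
  induction n with
  | zero =>
    rw [show pulls a i 0 = fun _ => 0 from funext (pulls_zero a i)]
    exact measurable_const
  | succ n ih =>
    rw [show pulls a i (n + 1) = _ from funext (pulls_succ a i n)]
    exact ih.add (Measurable.ite (ha _ (measurableSet_singleton i)) measurable_const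
      measurable_const)

lemma pulls_le_add_sum {Ω : Type*} {K : ℕ} (a : ℕ → Ω → Fin K) (i : Fin K) (u n : ℕ) (ω : Ω) :
    pulls a i n ω
      ≤ u + ∑ t ∈ Finset.range n, if a (t + 1) ω = i ∧ u ≤ pulls a i t ω then 1 else 0 := by
  induction n with
  | zero => simp [pulls_zero]
  | succ n ih =>
    rw [pulls_succ, Finset.sum_range_succ]
    set S := ∑ t ∈ Finset.range n, if a (t + 1) ω = i ∧ u ≤ pulls a i t ω then 1 else 0
    by_cases h : a (n + 1) ω = i <;> by_cases h' : u ≤ pulls a i n ω <;>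
      simp only [h, h', if_true, if_false, and_true, and_false] <;> omega

lemma one_le_pulls {Ω : Type*} {K : ℕ} {a : ℕ → Ω → Fin K} {ω : Ω}
    (hinit : ∀ t, 1 ≤ t → t ≤ K → ((a t ω : ℕ) = t - 1)) (i : Fin K) {n : ℕ} (hn : K ≤ n) :
    1 ≤ pulls a i n ω := by
  refine Finset.card_pos.2 ⟨i + 1, ?_⟩
  have := i.2
  simp only [Finset.mem_filter, Finset.mem_Icc]
  exact ⟨by omega, Fin.ext (by simpa using hinit (i + 1) (by omega) (by omega))⟩

lemma pulls_eq_zero_of_init {Ω : Type*} {K : ℕ} {a : ℕ → Ω → Fin K} {ω : Ω}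
    (hinit : ∀ t, 1 ≤ t → t ≤ K → ((a t ω : ℕ) = t - 1)) {i : Fin K} {t : ℕ} (ht : t < K)
    (hi : a (t + 1) ω = i) : pulls a i t ω = 0 := by
  unfold pulls
  rw [Finset.card_eq_zero, Finset.filter_eq_empty_iff]
  intro s hs hsi
  rw [Finset.mem_Icc] at hs
  have h1 := hinit s hs.1 (by omega)
  have h2 := hinit (t + 1) (by omega) (by omega)
  rw [hsi] at h1
  rw [hi] at h2
  omega

lemma measurable_ermEst {Ω : Type*} [MeasurableSpace Ω] {x : ℕ → Ω → ℝ}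
    (hx : ∀ t, Measurable (x t)) (β : ℝ) (n : ℕ) :
    Measurable fun ω => ermEst β n (fun t => x t ω) := by
  have hsum : Measurable fun ω => ∑ t ∈ Finset.range n, Real.exp (β * x t ω) :=
    Finset.measurable_fun_sum _ fun t _ => ((hx t).const_mul β).exp
  exact ((hsum.const_mul _).log).const_mul _

lemma measurable_apply_natIndex {Ω : Type*} [MeasurableSpace Ω] {F : ℕ → Ω → ℝ}
    (hF : ∀ n, Measurable (F n)) {N : Ω → ℕ} (hN : Measurable N) :
    Measurable fun ω => F (N ω) ω := by
  have hg : Measurable fun ω => (N ω, ω) := hN.prodMk measurable_id'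
  exact (measurable_from_prod_countable_right (f := fun p : ℕ × Ω => F p.1 p.2) hF).comp hg

lemma measurable_ermEst_comp {Ω : Type*} [MeasurableSpace Ω] {x : ℕ → Ω → ℝ}
    (hx : ∀ t, Measurable (x t)) (β : ℝ) {N : Ω → ℕ} (hN : Measurable N) :
    Measurable fun ω => ermEst β (N ω) (fun t => x t ω) :=
  measurable_apply_natIndex (F := fun n ω => ermEst β n (fun t => x t ω))
    (measurable_ermEst hx β) hN

lemma measureReal_mul_bonus_le {Ω : Type*} [MeasurableSpace Ω] {P : Measure Ω}
    {θ ξ η α : ℝ} (hθ : 1 < θ) (hξ : 1 < ξ) (hα : 0 < α) {s t : ℕ} (hs : 1 ≤ s)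
    (ht : 1 ≤ t) {D : Ω → ℝ}
    (hD : ∀ z : ℝ, 1 ≤ z → P {ω | (s : ℝ) ^ η * z ≤ D ω} ≤ ENNReal.ofReal (θ / z ^ ξ)) :
    P.real {ω | (s : ℝ) * bonus θ ξ η α t s ≤ D ω} ≤ (t : ℝ) ^ (-α) := by
  have hs0 : (0 : ℝ) < s := by exact_mod_cast hs
  have ht1 : (1 : ℝ) ≤ t := by exact_mod_cast ht
  have ht0 : (0 : ℝ) < t := by linarith
  have hξ0 : 0 < ξ := by linarith
  have hz : 1 ≤ θ ^ (1 / ξ) * (t : ℝ) ^ (α / ξ) :=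
    one_le_mul_of_one_le_of_one_le (Real.one_le_rpow hθ.le (by positivity))
      (Real.one_le_rpow ht1 (by positivity))
  have hb : (s : ℝ) * bonus θ ξ η α t s = (s : ℝ) ^ η * (θ ^ (1 / ξ) * (t : ℝ) ^ (α / ξ)) := by
    have h : (s : ℝ) = (s : ℝ) ^ η * (s : ℝ) ^ (1 - η) := by
      rw [← Real.rpow_add hs0]
      simp
    have h' : (s : ℝ) ^ (1 - η) ≠ 0 := by positivity
    rw [bonus, mul_div_assoc', div_eq_iff h']
    nth_rewrite 1 [h]
    ring
  have hzξ : θ / (θ ^ (1 / ξ) * (t : ℝ) ^ (α / ξ)) ^ ξ = (t : ℝ) ^ (-α) := by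
    rw [Real.mul_rpow (by positivity) (by positivity), ← Real.rpow_mul (by linarith),
      ← Real.rpow_mul ht0.le, one_div_mul_cancel hξ0.ne', div_mul_cancel₀ _ hξ0.ne',
      Real.rpow_one, Real.rpow_neg ht0.le]
    field_simp
  rw [hb, ← hzξ]
  exact ENNReal.toReal_le_of_le_ofReal (by positivity) (hD _ hz)

lemma integral_abs_le_of_tails {Ω : Type*} [MeasurableSpace Ω] {P : Measure Ω}
    [IsProbabilityMeasure P] {θ ξ c : ℝ} (hθ : 0 < θ) (hξ : 1 < ξ) (hc : 0 < c) {D : Ω → ℝ}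
    (hDint : Integrable D P)
    (hU : ∀ z : ℝ, 1 ≤ z → P {ω | c * z ≤ D ω} ≤ ENNReal.ofReal (θ / z ^ ξ))
    (hL : ∀ z : ℝ, 1 ≤ z → P {ω | D ω ≤ -(c * z)} ≤ ENNReal.ofReal (θ / z ^ ξ)) :
    ∫ ω, |D ω| ∂P ≤ c * (1 + 2 * θ / (ξ - 1)) := by
  have h : ∫ ω, |D ω| / c ∂P ≤ 1 + 2 * θ / (ξ - 1) := by
    refine integral_le_one_add_of_tail_le (hDint.abs.div_const c) (fun ω => by positivity) hξ
      fun z hz => ?_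
    have hz0 : 0 < z := by linarith
    have hsub : {ω | z ≤ |D ω| / c} ⊆ {ω | c * z ≤ D ω} ∪ {ω | D ω ≤ -(c * z)} := by
      intro ω hω
      have hω' : z * c ≤ |D ω| := (le_div_iff₀ hc).1 hω
      rcases le_abs.1 hω' with h | h
      · exact Or.inl (by simp only [Set.mem_ofPred_eq]; linarith)
      · exact Or.inr (by simp only [Set.mem_ofPred_eq]; linarith)
    have h1 : P.real {ω | c * z ≤ D ω} ≤ θ / z ^ ξ :=
      ENNReal.toReal_le_of_le_ofReal (by positivity) (hU z hz)
    have h2 : P.real {ω | D ω ≤ -(c * z)} ≤ θ / z ^ ξ :=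
      ENNReal.toReal_le_of_le_ofReal (by positivity) (hL z hz)
    calc P.real {ω | z ≤ |D ω| / c} ≤ _ := measureReal_mono hsub
      _ ≤ _ := measureReal_union_le _ _
      _ ≤ θ / z ^ ξ + θ / z ^ ξ := add_le_add h1 h2
      _ = 2 * θ * z ^ (-ξ) := by rw [Real.rpow_neg hz0.le]; ring
  rw [integral_div, div_le_iff₀ hc] at h
  linarith

lemma measureReal_late_pull_le {Ω : Type*} [MeasurableSpace Ω] {P : Measure Ω}
    [IsProbabilityMeasure P] {K : ℕ} {β : ℝ} {x : Fin K → ℕ → Ω → ℝ} {θ ξ η α : ℝ}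
    (hθ : 1 < θ) (hξ : 1 < ξ) (hη1 : η < 1) (hα : 0 < α) {μ : Fin K → ℝ}
    (hconcU : ∀ i, ∀ n : ℕ, 1 ≤ n → ∀ z : ℝ, 1 ≤ z →
      P {ω | (n : ℝ) ^ η * z ≤ (n : ℝ) * ermEst β n (fun t => x i t ω) - (n : ℝ) * μ i}
        ≤ ENNReal.ofReal (θ / z ^ ξ))
    (hconcL : ∀ i, ∀ n : ℕ, 1 ≤ n → ∀ z : ℝ, 1 ≤ z →
      P {ω | (n : ℝ) * ermEst β n (fun t => x i t ω) - (n : ℝ) * μ i ≤ -((n : ℝ) ^ η * z)}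
        ≤ ENNReal.ofReal (θ / z ^ ξ))
    {a : ℕ → Ω → Fin K}
    (hinit : ∀ ω, ∀ t, 1 ≤ t → t ≤ K → ((a t ω : ℕ) = t - 1))
    (hsel : ∀ ω, ∀ t, K < t → ∀ i : Fin K,
      ermEst β (pulls a (a t ω) (t - 1) ω) (fun u => x (a t ω) u ω)
          - bonus θ ξ η α t (pulls a (a t ω) (t - 1) ω)
        ≤ ermEst β (pulls a i (t - 1) ω) (fun u => x i u ω)
          - bonus θ ξ η α t (pulls a i (t - 1) ω))
    {i j : Fin K} {t u : ℕ} (ht : K ≤ t)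
    (hu : 2 * (θ ^ (1 / ξ) * ((t + 1 : ℕ) : ℝ) ^ (α / ξ)) ≤ (μ i - μ j) * (u : ℝ) ^ (1 - η))
    (hij : μ j < μ i) :
    P.real {ω | a (t + 1) ω = i ∧ u ≤ pulls a i t ω} ≤ 2 * ((t + 1 : ℕ) : ℝ) ^ (1 - α) := by
  set U : ℕ → Set Ω := fun s => {ω | (s : ℝ) * bonus θ ξ η α (t + 1) s
    ≤ (s : ℝ) * ermEst β s (fun t => x j t ω) - (s : ℝ) * μ j}
  set V : ℕ → Set Ω := fun s => {ω | (s : ℝ) * bonus θ ξ η α (t + 1) s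
    ≤ (s : ℝ) * μ i - (s : ℝ) * ermEst β s (fun t => x i t ω)}
  have hU : ∀ s ∈ Finset.Icc 1 t, P.real (U s) ≤ ((t + 1 : ℕ) : ℝ) ^ (-α) := fun s hs =>
    measureReal_mul_bonus_le hθ hξ hα (Finset.mem_Icc.1 hs).1 (by omega)
      (hconcU j s (Finset.mem_Icc.1 hs).1)
  have hV : ∀ s ∈ Finset.Icc 1 t, P.real (V s) ≤ ((t + 1 : ℕ) : ℝ) ^ (-α) := fun s hs =>
    measureReal_mul_bonus_le hθ hξ hα (Finset.mem_Icc.1 hs).1 (by omega) fun z hz => by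
      refine le_trans (measure_mono fun ω hω => ?_) (hconcL i s (Finset.mem_Icc.1 hs).1 z hz)
      simp only [Set.mem_ofPred_eq] at hω ⊢
      linarith
  have hsub : {ω | a (t + 1) ω = i ∧ u ≤ pulls a i t ω} ⊆ ⋃ s ∈ Finset.Icc 1 t, (U s ∪ V s) := by
    rintro ω ⟨hai, hui⟩
    have hsel' := hsel ω (t + 1) (by omega) j
    rw [hai, Nat.add_sub_cancel] at hsel'
    have hsi := one_le_pulls (hinit ω) i ht
    have hsj := one_le_pulls (hinit ω) j ht
    have hsi' := pulls_le a i t ω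
    have hsj' := pulls_le a j t ω
    set si := pulls a i t ω
    set sj := pulls a j t ω
    have hsi0 : (0 : ℝ) < si := by exact_mod_cast hsi
    have hsj0 : (0 : ℝ) < sj := by exact_mod_cast hsj
    have hbonus : 2 * bonus θ ξ η α (t + 1) si ≤ μ i - μ j := by
      rw [bonus, mul_div_assoc', div_le_iff₀ (by positivity)]
      refine hu.trans ?_
      have : (u : ℝ) ≤ si := by exact_mod_cast hui
      have h1 : 0 ≤ μ i - μ j := by linarith
      have h2 : 0 ≤ 1 - η := by linarith
      gcongr
    simp only [Set.mem_iUnion, Set.mem_union]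
    by_cases hcase : bonus θ ξ η α (t + 1) sj ≤ ermEst β sj (fun t => x j t ω) - μ j
    · refine ⟨sj, Finset.mem_Icc.2 ⟨hsj, hsj'⟩, Or.inl ?_⟩
      simp only [U, Set.mem_ofPred_eq]
      nlinarith
    · refine ⟨si, Finset.mem_Icc.2 ⟨hsi, hsi'⟩, Or.inr ?_⟩
      have : bonus θ ξ η α (t + 1) si ≤ μ i - ermEst β si (fun t => x i t ω) := by linarith
      simp only [V, Set.mem_ofPred_eq]
      nlinarith
  have ht0 : (0 : ℝ) < ((t + 1 : ℕ) : ℝ) := by positivity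
  calc P.real {ω | a (t + 1) ω = i ∧ u ≤ pulls a i t ω}
      ≤ P.real (⋃ s ∈ Finset.Icc 1 t, (U s ∪ V s)) := measureReal_mono hsub (measure_ne_top P _)
    _ ≤ ∑ s ∈ Finset.Icc 1 t, P.real (U s ∪ V s) := measureReal_biUnion_finset_le _ _
    _ ≤ ∑ _s ∈ Finset.Icc 1 t, 2 * ((t + 1 : ℕ) : ℝ) ^ (-α) :=
        Finset.sum_le_sum fun s hs => by
          linarith [measureReal_union_le (μ := P) (U s) (V s), hU s hs, hV s hs]
    _ = (t : ℝ) * (2 * ((t + 1 : ℕ) : ℝ) ^ (-α)) := by simp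
    _ ≤ ((t + 1 : ℕ) : ℝ) * (2 * ((t + 1 : ℕ) : ℝ) ^ (-α)) := by
        gcongr
        simp
    _ = 2 * ((t + 1 : ℕ) : ℝ) ^ (1 - α) := by
        rw [sub_eq_add_neg 1 α, Real.rpow_add ht0, Real.rpow_one]
        ring

lemma integrable_pulls {Ω : Type*} [MeasurableSpace Ω] {P : Measure Ω} [IsProbabilityMeasure P]
    {K : ℕ} {a : ℕ → Ω → Fin K} (ha : ∀ t, Measurable (a t)) (i : Fin K) (n : ℕ) :
    Integrable (fun ω => (pulls a i n ω : ℝ)) P := by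
  refine Integrable.of_bound ((measurable_from_nat (f := fun k : ℕ => (k : ℝ))).comp
    (measurable_pulls ha i n)).aestronglyMeasurable n (.of_forall fun ω => ?_)
  simpa using pulls_le a i n ω

lemma integral_pulls_le {Ω : Type*} [MeasurableSpace Ω] {P : Measure Ω}
    [IsProbabilityMeasure P] {K : ℕ} {a : ℕ → Ω → Fin K} (ha : ∀ t, Measurable (a t))
    (hinit : ∀ ω, ∀ t, 1 ≤ t → t ≤ K → ((a t ω : ℕ) = t - 1)) {α : ℝ} (hα : 2 < α)
    {i : Fin K} {n u : ℕ} (hu : 1 ≤ u)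
    (hlate : ∀ t, K ≤ t → t < n →
      P.real {ω | a (t + 1) ω = i ∧ u ≤ pulls a i t ω} ≤ 2 * ((t + 1 : ℕ) : ℝ) ^ (1 - α)) :
    ∫ ω, (pulls a i n ω : ℝ) ∂P ≤ u + 2 / (α - 2) := by
  set S : ℕ → Set Ω := fun t => {ω | a (t + 1) ω = i ∧ u ≤ pulls a i t ω}
  have hS : ∀ t, MeasurableSet (S t) := fun t =>
    (ha (t + 1) (measurableSet_singleton i)).inter (measurable_pulls ha i t measurableSet_Ici)
  have hSint : ∀ t, Integrable ((S t).indicator (1 : Ω → ℝ)) P := fun t =>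
    (integrable_const 1).indicator (hS t)
  have hempty : ∀ t, t < K → S t = ∅ := fun t ht => by
    refine Set.eq_empty_of_forall_notMem fun ω hω => ?_
    have := pulls_eq_zero_of_init (hinit ω) ht hω.1
    have := hω.2
    omega
  have hK : 0 < K := i.pos
  have hbound : ∀ t, t < n → P.real (S t) ≤ 2 * ((t + 1 : ℕ) : ℝ) ^ (1 - α) := fun t htn => by
    rcases lt_or_ge t K with ht | ht
    · rw [hempty t ht, measureReal_empty]
      positivity
    · exact hlate t ht htn
  calc ∫ ω, (pulls a i n ω : ℝ) ∂P
      ≤ ∫ ω, ((u : ℝ) + ∑ t ∈ Finset.range n, (S t).indicator (1 : Ω → ℝ) ω) ∂P := by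
        refine integral_mono (integrable_pulls ha i n)
          ((integrable_const _).add (integrable_finsetSum _ fun t _ => hSint t)) fun ω => ?_
        have h := pulls_le_add_sum a i u n ω
        have h' : (pulls a i n ω : ℝ) ≤ (u : ℝ) + ∑ t ∈ Finset.range n,
            ((if a (t + 1) ω = i ∧ u ≤ pulls a i t ω then 1 else 0 : ℕ) : ℝ) := by
          exact_mod_cast h
        simpa [S, Set.indicator_apply] using h'
    _ = u + ∑ t ∈ Finset.range n, P.real (S t) := by
        rw [integral_add (integrable_const _) (integrable_finsetSum _ fun t _ => hSint t),
          integral_finsetSum _ fun t _ => hSint t]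
        simp [integral_indicator_one (hS _)]
    _ = u + ∑ t ∈ Finset.Ico 1 n, P.real (S t) := by
        congr 1
        refine (Finset.sum_subset (fun t ht => ?_) fun t ht ht' => ?_).symm
        · exact Finset.mem_range.2 (Finset.mem_Ico.1 ht).2
        · have : t = 0 := by
            simp only [Finset.mem_range, Finset.mem_Ico] at ht ht'
            omega
          rw [hempty t (by omega), measureReal_empty]
    _ ≤ u + ∑ t ∈ Finset.Ico 1 n, 2 * ((t + 1 : ℕ) : ℝ) ^ (1 - α) := by
        gcongr with t ht
        exact hbound t (Finset.mem_Ico.1 ht).2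
    _ ≤ u + 2 * (1 / (α - 2)) := by
        rw [← Finset.mul_sum]
        gcongr
        exact sum_Ico_add_one_rpow_le hα n
    _ = u + 2 / (α - 2) := by ring

lemma abs_mul_ermEst_sub_sum_le {Ω : Type*} {K : ℕ} {β R : ℝ} (hβ : 0 < β) (hR : 0 < R)
    {x : Fin K → ℕ → Ω → ℝ} (hx : ∀ i t ω, x i t ω ∈ Set.Icc (-R) R) (a : ℕ → Ω → Fin K)
    (j : Fin K) (n : ℕ) (ω : Ω) :
    |(n : ℝ) * ermEst β n (fun t => x j t ω)
        - ∑ i, (pulls a i n ω : ℝ) * ermEst β (pulls a i n ω) (fun t => x i t ω)|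
      ≤ (2 * R + (Real.exp (2 * β * R) - 1) / β)
        * ∑ i ∈ Finset.univ.erase j, (pulls a i n ω : ℝ) := by
  have hsum : ∑ i ∈ Finset.univ.erase j, (pulls a i n ω : ℝ) = n - pulls a j n ω := by
    rw [eq_sub_iff_add_eq, Finset.sum_erase_add _ _ (Finset.mem_univ j)]
    exact_mod_cast sum_pulls a n ω
  rw [← Finset.sum_erase_add _ _ (Finset.mem_univ j)]
  have hle : (pulls a j n ω : ℝ) ≤ n := by exact_mod_cast pulls_le a j n ω
  have h1 := mul_abs_ermEst_sub_le hβ hR (fun t => hx j t ω) (pulls_le a j n ω)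
  have h2 : |((n : ℝ) - pulls a j n ω) * ermEst β n (fun t => x j t ω)|
      ≤ (n - pulls a j n ω) * R := by
    rw [abs_mul, abs_of_nonneg (sub_nonneg.2 hle)]
    exact mul_le_mul_of_nonneg_left (abs_ermEst_le hβ hR (fun t => hx j t ω) n) (by linarith)
  have h3 : |∑ i ∈ Finset.univ.erase j, (pulls a i n ω : ℝ)
      * ermEst β (pulls a i n ω) (fun t => x i t ω)| ≤ (n - pulls a j n ω) * R := by
    rw [← hsum, Finset.sum_mul]
    refine (Finset.abs_sum_le_sum_abs _ _).trans (Finset.sum_le_sum fun i _ => ?_)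
    rw [abs_mul, Nat.abs_cast]
    exact mul_le_mul_of_nonneg_left (abs_ermEst_le hβ hR (fun t => hx i t ω) _) (by positivity)
  rw [← abs_of_nonneg (Nat.cast_nonneg (α := ℝ) (pulls a j n ω)), ← abs_mul,
    abs_of_nonneg (Nat.cast_nonneg (α := ℝ) (pulls a j n ω))] at h1
  rw [hsum]
  rw [abs_le] at h1 h2 h3 ⊢
  constructor <;> nlinarith

lemma integral_pulls_suboptimal_le {Ω : Type*} [MeasurableSpace Ω] {P : Measure Ω}
    [IsProbabilityMeasure P] {K : ℕ} {β : ℝ} {x : Fin K → ℕ → Ω → ℝ} {θ ξ η α : ℝ}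
    (hθ : 1 < θ) (hξ : 1 < ξ) (hη1 : η < 1) (hα : 2 < α) {μ : Fin K → ℝ}
    (hconcU : ∀ i, ∀ n : ℕ, 1 ≤ n → ∀ z : ℝ, 1 ≤ z →
      P {ω | (n : ℝ) ^ η * z ≤ (n : ℝ) * ermEst β n (fun t => x i t ω) - (n : ℝ) * μ i}
        ≤ ENNReal.ofReal (θ / z ^ ξ))
    (hconcL : ∀ i, ∀ n : ℕ, 1 ≤ n → ∀ z : ℝ, 1 ≤ z →
      P {ω | (n : ℝ) * ermEst β n (fun t => x i t ω) - (n : ℝ) * μ i ≤ -((n : ℝ) ^ η * z)}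
        ≤ ENNReal.ofReal (θ / z ^ ξ))
    {a : ℕ → Ω → Fin K} (ha : ∀ t, Measurable (a t))
    (hinit : ∀ ω, ∀ t, 1 ≤ t → t ≤ K → ((a t ω : ℕ) = t - 1))
    (hsel : ∀ ω, ∀ t, K < t → ∀ i : Fin K,
      ermEst β (pulls a (a t ω) (t - 1) ω) (fun u => x (a t ω) u ω)
          - bonus θ ξ η α t (pulls a (a t ω) (t - 1) ω)
        ≤ ermEst β (pulls a i (t - 1) ω) (fun u => x i u ω)
          - bonus θ ξ η α t (pulls a i (t - 1) ω))
    {i j : Fin K} {Δ : ℝ} (hΔ : 0 < Δ) (hΔij : Δ ≤ μ i - μ j) {n : ℕ} (hn : 1 ≤ n) :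
    ∫ ω, (pulls a i n ω : ℝ) ∂P
      ≤ (2 * θ ^ (1 / ξ) / Δ) ^ (1 / (1 - η)) * (n : ℝ) ^ (α / (ξ * (1 - η)))
        + 2 / (α - 2) + 1 := by
  have hθ0 : 0 < θ := by linarith
  have hξ0 : 0 < ξ := by linarith
  have hη0 : 0 < 1 - η := by linarith
  have hα0 : 0 < α := by linarith
  have hn0 : (0 : ℝ) < n := by exact_mod_cast hn
  set A := (2 * θ ^ (1 / ξ) / Δ) ^ (1 / (1 - η)) * (n : ℝ) ^ (α / (ξ * (1 - η))) with hA
  have hA0 : 0 < A := by positivity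
  have hAη : A ^ (1 - η) = 2 * θ ^ (1 / ξ) / Δ * (n : ℝ) ^ (α / ξ) := by
    rw [hA, Real.mul_rpow (by positivity) (by positivity), ← Real.rpow_mul (by positivity),
      ← Real.rpow_mul hn0.le, one_div_mul_cancel hη0.ne', Real.rpow_one]
    congr 2
    field_simp
  have hu := integral_pulls_le (P := P) ha hinit hα (i := i) (n := n) (u := ⌈A⌉₊)
    (Nat.one_le_ceil_iff.2 hA0) fun t ht htn => by
      refine measureReal_late_pull_le hθ hξ hη1 hα0 hconcU hconcL hinit hsel (j := j) ht ?_
        (by linarith)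
      have htn' : ((t + 1 : ℕ) : ℝ) ≤ n := by exact_mod_cast htn
      calc 2 * (θ ^ (1 / ξ) * ((t + 1 : ℕ) : ℝ) ^ (α / ξ))
          ≤ 2 * (θ ^ (1 / ξ) * (n : ℝ) ^ (α / ξ)) := by gcongr
        _ = Δ * A ^ (1 - η) := by rw [hAη]; field_simp
        _ ≤ (μ i - μ j) * (⌈A⌉₊ : ℝ) ^ (1 - η) := by
          gcongr
          · linarith
          · exact Nat.le_ceil A
  linarith [Nat.ceil_lt_add_one hA0.le]

lemma integrable_mul_ermEst_pulls {Ω : Type*} [MeasurableSpace Ω] {P : Measure Ω}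
    [IsProbabilityMeasure P] {K : ℕ} {β R : ℝ} (hβ : 0 < β) (hR : 0 < R)
    {x : Fin K → ℕ → Ω → ℝ} (hxmeas : ∀ i t, Measurable (x i t))
    (hx : ∀ i t ω, x i t ω ∈ Set.Icc (-R) R) {a : ℕ → Ω → Fin K}
    (ha : ∀ t, Measurable (a t)) (i : Fin K) (n : ℕ) :
    Integrable (fun ω => (pulls a i n ω : ℝ) * ermEst β (pulls a i n ω) (fun t => x i t ω)) P :=
  (integrable_pulls ha i n).mul_bdd (c := R)
    (measurable_ermEst_comp (hxmeas i) β (measurable_pulls ha i n)).aestronglyMeasurable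
    (.of_forall fun ω => abs_ermEst_le hβ hR (fun t => hx i t ω) _)

lemma abs_sub_integral_empirical_le {Ω : Type*} [MeasurableSpace Ω] {P : Measure Ω}
    [IsProbabilityMeasure P] {K : ℕ} {β R : ℝ} (hβ : 0 < β) (hR : 0 < R)
    {x : Fin K → ℕ → Ω → ℝ} (hxmeas : ∀ i t, Measurable (x i t))
    (hx : ∀ i t ω, x i t ω ∈ Set.Icc (-R) R) {a : ℕ → Ω → Fin K}
    (ha : ∀ t, Measurable (a t)) {j : Fin K} {m c B : ℝ} {n : ℕ} (hn : 1 ≤ n)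
    (hdev : ∫ ω, |(n : ℝ) * ermEst β n (fun t => x j t ω) - n * m| ∂P ≤ c)
    (hpulls : ∀ i, i ≠ j → ∫ ω, (pulls a i n ω : ℝ) ∂P ≤ B) :
    |m - ∫ ω, (1 / (n : ℝ)) * ∑ i, (pulls a i n ω : ℝ) *
        ermEst β (pulls a i n ω) (fun t => x i t ω) ∂P|
      ≤ c / n + (1 / (n : ℝ)) * (2 * R + (Real.exp (2 * β * R) - 1) / β) * ((K : ℝ) - 1) * B := by
  have hn0 : (0 : ℝ) < n := by exact_mod_cast hn
  set M := 2 * R + (Real.exp (2 * β * R) - 1) / β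
  have hM : 0 ≤ M := by
    have := Real.one_le_exp (by positivity : 0 ≤ 2 * β * R)
    have : 0 ≤ (Real.exp (2 * β * R) - 1) / β := div_nonneg (by linarith) hβ.le
    positivity
  set S : Ω → ℝ := fun ω => ∑ i, (pulls a i n ω : ℝ) *
    ermEst β (pulls a i n ω) (fun t => x i t ω)
  set N : Ω → ℝ := fun ω => ∑ i ∈ Finset.univ.erase j, (pulls a i n ω : ℝ)
  set D : Ω → ℝ := fun ω => (n : ℝ) * ermEst β n (fun t => x j t ω) - n * m
  have hS : Integrable S P :=
    integrable_finsetSum _ fun i _ => integrable_mul_ermEst_pulls hβ hR hxmeas hx ha i n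
  have hN : Integrable N P := integrable_finsetSum _ fun i _ => integrable_pulls ha i n
  have hD : Integrable D P := by
    refine Integrable.sub (Integrable.const_mul ?_ _) (integrable_const _)
    exact Integrable.of_bound (measurable_ermEst (hxmeas j) β n).aestronglyMeasurable R
      (.of_forall fun ω => abs_ermEst_le hβ hR (fun t => hx j t ω) n)
  have hNint : ∫ ω, N ω ∂P ≤ ((K : ℝ) - 1) * B := by
    rw [integral_finsetSum _ fun i _ => integrable_pulls ha i n]
    have h := Finset.sum_le_card_nsmul (Finset.univ.erase j)
      (fun i => ∫ ω, (pulls a i n ω : ℝ) ∂P) B fun i hi => hpulls i (Finset.ne_of_mem_erase hi)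
    have hK : 1 ≤ K := j.pos
    rw [Finset.card_erase_of_mem (Finset.mem_univ j), Finset.card_univ, Fintype.card_fin,
      nsmul_eq_mul, Nat.cast_sub hK, Nat.cast_one] at h
    exact h
  have hmean : m - ∫ ω, (1 / (n : ℝ)) * S ω ∂P = (1 / (n : ℝ)) * ∫ ω, (n * m - S ω) ∂P := by
    rw [integral_const_mul, integral_sub (integrable_const _) hS]
    simp
    field_simp
  have hmain : |∫ ω, (n * m - S ω) ∂P| ≤ c + M * (((K : ℝ) - 1) * B) :=
    calc |∫ ω, (n * m - S ω) ∂P| ≤ ∫ ω, |n * m - S ω| ∂P := abs_integral_le_integral_abs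
      _ ≤ ∫ ω, (|D ω| + M * N ω) ∂P := by
          refine integral_mono ((integrable_const _).sub hS).abs
            (hD.abs.add (hN.const_mul M)) fun ω => ?_
          have h := abs_mul_ermEst_sub_sum_le hβ hR hx a j n ω
          have h' := abs_sub_le ((n : ℝ) * m) ((n : ℝ) * ermEst β n (fun t => x j t ω)) (S ω)
          rw [abs_sub_comm ((n : ℝ) * m) ((n : ℝ) * _)] at h'
          exact h'.trans (add_le_add le_rfl h)
      _ = ∫ ω, |D ω| ∂P + M * ∫ ω, N ω ∂P := by
          rw [integral_add hD.abs (hN.const_mul M), integral_const_mul]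
      _ ≤ c + M * (((K : ℝ) - 1) * B) := by gcongr
  rw [hmean, abs_mul, abs_of_pos (by positivity : 0 < 1 / (n : ℝ))]
  calc (1 / (n : ℝ)) * |∫ ω, (n * m - S ω) ∂P|
      ≤ (1 / (n : ℝ)) * (c + M * (((K : ℝ) - 1) * B)) := by gcongr
    _ = _ := by ring

lemma convergence_bound_le_rate {β R η κ G A B y : ℝ} (hβ : 0 < β) (hR : 0 < R) (hηκ : η ≤ κ)
    (hκ : 0 ≤ κ) (hG : 0 ≤ G) (hA : 0 ≤ A) (hB : 0 ≤ B) {k : ℝ} (hk : 0 ≤ k) (hy : 1 ≤ y) :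
    y ^ (η - 1) * G + (1 / y) * (2 * R + (Real.exp (2 * β * R) - 1) / β) * k
        * (A * y ^ κ + B + 1)
      ≤ (G + (2 * R + 1 / β) * k * (A + B + 1)) * Real.exp (2 * β * R) * y ^ (κ - 1) := by
  have hy0 : 0 < y := by linarith
  set E := Real.exp (2 * β * R)
  have hE : 1 ≤ E := Real.one_le_exp (by positivity)
  have h1 : y ^ (η - 1) ≤ y ^ (κ - 1) := Real.rpow_le_rpow_of_exponent_le hy (by linarith)
  have h2 : 1 ≤ y ^ κ := Real.one_le_rpow hy hκ
  have hM : 2 * R + (E - 1) / β ≤ (2 * R + 1 / β) * E := by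
    have : (E - 1) / β ≤ 1 / β * E := by
      rw [one_div_mul_eq_div]
      gcongr
      linarith
    nlinarith
  have hM0 : 0 ≤ (2 * R + 1 / β) * E := by positivity
  have hp : 0 < y ^ (κ - 1) := by positivity
  have hpow : (1 / y) * y ^ κ = y ^ (κ - 1) := by
    rw [Real.rpow_sub_one hy0.ne']
    ring
  have hfirst : y ^ (η - 1) * G ≤ G * E * y ^ (κ - 1) := by
    calc y ^ (η - 1) * G ≤ y ^ (κ - 1) * G := by gcongr
      _ ≤ y ^ (κ - 1) * G * E := le_mul_of_one_le_right (by positivity) hE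
      _ = G * E * y ^ (κ - 1) := by ring
  have hsecond : (1 / y) * (2 * R + (E - 1) / β) * k * (A * y ^ κ + B + 1)
      ≤ (2 * R + 1 / β) * k * (A + B + 1) * E * y ^ (κ - 1) := by
    have hABy : A * y ^ κ + B + 1 ≤ (A + B + 1) * y ^ κ := by nlinarith
    calc (1 / y) * (2 * R + (E - 1) / β) * k * (A * y ^ κ + B + 1)
        ≤ (1 / y) * ((2 * R + 1 / β) * E) * k * ((A + B + 1) * y ^ κ) := by gcongr
      _ = (2 * R + 1 / β) * k * (A + B + 1) * E * ((1 / y) * y ^ κ) := by ring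
      _ = _ := by rw [hpow]
  calc _ ≤ G * E * y ^ (κ - 1) + (2 * R + 1 / β) * k * (A + B + 1) * E * y ^ (κ - 1) :=
        add_le_add hfirst hsecond
    _ = _ := by ring

/-- convergence of the empirical ERM_β `ρ̄_n = (1/n) Σ_i T_i(n) ρ̂_{i,T_i(n)}`
of the UCB-ERM algorithm on a non-stationary `K`-armed bandit satisfying Assumption A2:
the explicit bound for `n ≥ K`, the `O(exp(2βR) n^{α/(ξ(1−η))−1})` rate, and
`lim E[ρ̄_n] = μ*`. -/
theorem stmt5 {Ω : Type*} [MeasurableSpace Ω] (P : Measure Ω) [IsProbabilityMeasure P]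
    (K : ℕ) (hK : 1 ≤ K) (R β : ℝ) (hR : 0 < R) (hβ : 0 < β)
    -- the costs: `x i t ω` is the cost received on the `(t+1)`-th pull of arm `i`
    (x : Fin K → ℕ → Ω → ℝ) (hxmeas : ∀ i t, Measurable (x i t))
    (hxbdd : ∀ i t ω, x i t ω ∈ Set.Icc (-R) R)
    -- Assumption A2 constants and exploration parameter
    (θ ξ η α : ℝ) (hθ : 1 < θ) (hξ : 1 < ξ) (hη : 1 / 2 ≤ η) (hη1 : η < 1)
    (hα2 : 2 < α) (hαl : ξ * η * (1 - η) ≤ α) (hαu : α < ξ * (1 - η))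
    -- Assumption A2: limits exist and polynomial concentration holds
    (μ : Fin K → ℝ)
    (hconv : ∀ i, Tendsto (fun n => ∫ ω, ermEst β n (fun t => x i t ω) ∂P) atTop
      (nhds (μ i)))
    (hconcU : ∀ i, ∀ n : ℕ, 1 ≤ n → ∀ z : ℝ, 1 ≤ z →
      P {ω | (n : ℝ) ^ η * z ≤ (n : ℝ) * ermEst β n (fun t => x i t ω) - (n : ℝ) * μ i}
        ≤ ENNReal.ofReal (θ / z ^ ξ))
    (hconcL : ∀ i, ∀ n : ℕ, 1 ≤ n → ∀ z : ℝ, 1 ≤ z →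
      P {ω | (n : ℝ) * ermEst β n (fun t => x i t ω) - (n : ℝ) * μ i ≤ -((n : ℝ) ^ η * z)}
        ≤ ENNReal.ofReal (θ / z ^ ξ))
    -- unique optimal arm, optimal value `μ* = μ i*`, and minimal gap
    (istar : Fin K) (hstar : ∀ i, i ≠ istar → μ istar < μ i)
    (Δmin : ℝ) (hΔ : IsLeast {d | ∃ i, i ≠ istar ∧ d = μ i - μ istar} Δmin)
    -- the UCB-ERM algorithm: `a t ω` is the arm pulled at round `t ≥ 1`
    (a : ℕ → Ω → Fin K) (hameas : ∀ t, Measurable (a t))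
    (hinit : ∀ ω, ∀ t, 1 ≤ t → t ≤ K → ((a t ω : ℕ) = t - 1))
    (hsel : ∀ ω, ∀ t, K < t → ∀ i : Fin K,
      ermEst β (pulls a (a t ω) (t - 1) ω) (fun u => x (a t ω) u ω)
          - bonus θ ξ η α t (pulls a (a t ω) (t - 1) ω)
        ≤ ermEst β (pulls a i (t - 1) ω) (fun u => x i u ω)
          - bonus θ ξ η α t (pulls a i (t - 1) ω)) :
    (∀ n : ℕ, K ≤ n →
      |μ istar - ∫ ω, (1 / (n : ℝ)) * ∑ i, (pulls a i n ω : ℝ) *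
          ermEst β (pulls a i n ω) (fun t => x i t ω) ∂P|
        ≤ (n : ℝ) ^ (η - 1) * (1 + 2 * θ / (ξ - 1))
          + (1 / (n : ℝ)) * (2 * R + (Real.exp (2 * β * R) - 1) / β) * ((K : ℝ) - 1)
            * ((2 * θ ^ (1 / ξ) / Δmin) ^ (1 / (1 - η)) * (n : ℝ) ^ (α / (ξ * (1 - η)))
                + 2 / (α - 2) + 1)) ∧
    (∃ C : ℝ, 0 < C ∧ ∀ n : ℕ, K ≤ n →
      |μ istar - ∫ ω, (1 / (n : ℝ)) * ∑ i, (pulls a i n ω : ℝ) *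
          ermEst β (pulls a i n ω) (fun t => x i t ω) ∂P|
        ≤ C * Real.exp (2 * β * R) * (n : ℝ) ^ (α / (ξ * (1 - η)) - 1)) ∧
    Tendsto (fun n : ℕ => ∫ ω, (1 / (n : ℝ)) * ∑ i, (pulls a i n ω : ℝ) *
        ermEst β (pulls a i n ω) (fun t => x i t ω) ∂P) atTop (nhds (μ istar)) := by
  obtain ⟨i₀, hi₀, hΔ₀⟩ := hΔ.1
  have hΔpos : 0 < Δmin := by linarith [hstar i₀ hi₀]
  have hξ0 : 0 < ξ := by linarith
  have hη0 : 0 < 1 - η := by linarith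
  have hθ0 : 0 < θ := by linarith
  have hbound : ∀ n : ℕ, K ≤ n →
      |μ istar - ∫ ω, (1 / (n : ℝ)) * ∑ i, (pulls a i n ω : ℝ) *
          ermEst β (pulls a i n ω) (fun t => x i t ω) ∂P|
        ≤ (n : ℝ) ^ (η - 1) * (1 + 2 * θ / (ξ - 1))
          + (1 / (n : ℝ)) * (2 * R + (Real.exp (2 * β * R) - 1) / β) * ((K : ℝ) - 1)
            * ((2 * θ ^ (1 / ξ) / Δmin) ^ (1 / (1 - η)) * (n : ℝ) ^ (α / (ξ * (1 - η)))
                + 2 / (α - 2) + 1) := by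
    intro n hn
    have hn1 : 1 ≤ n := hK.trans hn
    have hn0 : (0 : ℝ) < n := by exact_mod_cast hn1
    have hint : Integrable (fun ω => (n : ℝ) * ermEst β n (fun t => x istar t ω)
        - n * μ istar) P := by
      refine Integrable.sub (Integrable.const_mul ?_ _) (integrable_const _)
      exact Integrable.of_bound (measurable_ermEst (hxmeas istar) β n).aestronglyMeasurable R
        (.of_forall fun ω => abs_ermEst_le hβ hR (fun t => hxbdd istar t ω) n)
    have hdev := integral_abs_le_of_tails hθ0 hξ (by positivity : 0 < (n : ℝ) ^ η) hint
      (hconcU istar n hn1) (hconcL istar n hn1)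
    refine (abs_sub_integral_empirical_le hβ hR hxmeas hxbdd hameas hn1 hdev fun i hi =>
      integral_pulls_suboptimal_le hθ hξ hη1 hα2 hconcU hconcL hameas hinit hsel hΔpos
        (hΔ.2 ⟨i, hi, rfl⟩) hn1).trans_eq ?_
    rw [Real.rpow_sub_one hn0.ne']
    ring
  have hκ : α / (ξ * (1 - η)) < 1 := by rwa [div_lt_one (by positivity)]
  have hηκ : η ≤ α / (ξ * (1 - η)) := by
    rw [le_div_iff₀ (by positivity)]
    linarith
  have hG : 0 < 1 + 2 * θ / (ξ - 1) := by
    have : 0 < ξ - 1 := by linarith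
    positivity
  have hα0 : 0 < α - 2 := by linarith
  have hK0 : 0 ≤ (K : ℝ) - 1 := by
    have : (1 : ℝ) ≤ K := by exact_mod_cast hK
    linarith
  have hrate : ∃ C : ℝ, 0 < C ∧ ∀ n : ℕ, K ≤ n →
      |μ istar - ∫ ω, (1 / (n : ℝ)) * ∑ i, (pulls a i n ω : ℝ) *
          ermEst β (pulls a i n ω) (fun t => x i t ω) ∂P|
        ≤ C * Real.exp (2 * β * R) * (n : ℝ) ^ (α / (ξ * (1 - η)) - 1) :=
    ⟨(1 + 2 * θ / (ξ - 1)) + (2 * R + 1 / β) * ((K : ℝ) - 1)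
        * ((2 * θ ^ (1 / ξ) / Δmin) ^ (1 / (1 - η)) + 2 / (α - 2) + 1), by positivity,
      fun n hn => (hbound n hn).trans
        (convergence_bound_le_rate hβ hR hηκ (by linarith) hG.le (by positivity) (by positivity)
          hK0 (by exact_mod_cast hK.trans hn))⟩
  refine ⟨hbound, hrate, ?_⟩
  obtain ⟨C, -, hC⟩ := hrate
  rw [tendsto_iff_dist_tendsto_zero]
  have hlim : Tendsto (fun n : ℕ => C * Real.exp (2 * β * R)
      * (n : ℝ) ^ (α / (ξ * (1 - η)) - 1)) atTop (nhds 0) := by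
    have h := (tendsto_rpow_neg_atTop (sub_pos.2 hκ)).comp tendsto_natCast_atTop_atTop
    simpa [Function.comp_def] using h.const_mul (C * Real.exp (2 * β * R))
  refine squeeze_zero' (.of_forall fun _ => dist_nonneg) ?_ hlim
  filter_upwards [eventually_ge_atTop K] with n hn
  rw [dist_comm, Real.dist_eq]
  exact hC n hn
end

section
/- Consider a non-stationary K-armed bandit satisfying Assumption A2 with constants θ, ξ, η and exploration parameter α > 0. Let i ∈ {1,…,K} be a sub-optimal arm (Δ_i > 0), let b_{t,s} = θ^{1/ξ} t^{α/ξ} / s^{1−η}, and let A_i(t) = ⌈((2/Δ_i) θ^{1/ξ} t^{α/ξ})^{1/(1−η)}⌉. Then for every s, t ∈ ℕ with A_i(t) ≤ s ≤ t: P[ρ̂_{i,s} − b_{t,s} < μ*] ≤ t^{−α}. -/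
open MeasureTheory ProbabilityTheory Filter

/-- Lemma 1: on a non-stationary `K`-armed bandit satisfying Assumption A2,
for a sub-optimal arm `i` and `A_i(t) = ⌈((2/Δ_i) θ^{1/ξ} t^{α/ξ})^{1/(1−η)}⌉`, for all
rounds `s, t` with `A_i(t) ≤ s ≤ t` one has `P[ρ̂_{i,s} − b_{t,s} < μ*] ≤ t^{−α}`. -/
theorem stmt7 {Ω : Type*} [MeasurableSpace Ω] (P : Measure Ω) [IsProbabilityMeasure P]
    (K : ℕ) (hK : 1 ≤ K) (R β : ℝ) (hR : 0 < R) (hβ : 0 < β)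
    (x : Fin K → ℕ → Ω → ℝ) (hxmeas : ∀ i t, Measurable (x i t))
    (hxbdd : ∀ i t ω, x i t ω ∈ Set.Icc (-R) R)
    (θ ξ η α : ℝ) (hθ : 1 < θ) (hξ : 1 < ξ) (hη : 1 / 2 ≤ η) (hη1 : η < 1) (hα : 0 < α)
    (μ : Fin K → ℝ)
    (hconv : ∀ i, Tendsto (fun n => ∫ ω, ermEst β n (fun t => x i t ω) ∂P) atTop
      (nhds (μ i)))
    (hconcU : ∀ i, ∀ n : ℕ, 1 ≤ n → ∀ z : ℝ, 1 ≤ z →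
      P {ω | (n : ℝ) ^ η * z ≤ (n : ℝ) * ermEst β n (fun t => x i t ω) - (n : ℝ) * μ i}
        ≤ ENNReal.ofReal (θ / z ^ ξ))
    (hconcL : ∀ i, ∀ n : ℕ, 1 ≤ n → ∀ z : ℝ, 1 ≤ z →
      P {ω | (n : ℝ) * ermEst β n (fun t => x i t ω) - (n : ℝ) * μ i ≤ -((n : ℝ) ^ η * z)}
        ≤ ENNReal.ofReal (θ / z ^ ξ))
    (istar : Fin K) (hstar : ∀ j, j ≠ istar → μ istar < μ j)
    -- a sub-optimal arm `i`, i.e. `Δ_i = μ i − μ* > 0`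
    (i : Fin K) (hi : 0 < μ i - μ istar) :
    ∀ s t : ℕ, 1 ≤ t →
      ⌈((2 / (μ i - μ istar)) * θ ^ (1 / ξ) * (t : ℝ) ^ (α / ξ)) ^ (1 / (1 - η))⌉₊ ≤ s →
      s ≤ t →
      P {ω | ermEst β s (fun u => x i u ω) - bonus θ ξ η α t s < μ istar}
        ≤ ENNReal.ofReal ((t : ℝ) ^ (-α)) := by
  intro s t ht hs _
  set Δ := μ i - μ istar with hΔ
  have ht0 : (0 : ℝ) < t := by exact_mod_cast ht
  have ht1 : (1 : ℝ) ≤ t := by exact_mod_cast ht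
  have hθ0 : 0 < θ := by linarith
  have hξ0 : 0 < ξ := by linarith
  have hη0 : 0 < 1 - η := by linarith
  obtain ⟨c, hc⟩ : ∃ c, c = θ ^ (1 / ξ) * (t : ℝ) ^ (α / ξ) := ⟨_, rfl⟩
  have hc1 : 1 ≤ c := by
    rw [hc]
    exact one_le_mul_of_one_le_of_one_le
      (Real.one_le_rpow hθ.le (by positivity)) (Real.one_le_rpow ht1 (by positivity))
  have hcξ : θ / c ^ ξ = (t : ℝ) ^ (-α) := by
    rw [hc, Real.mul_rpow (by positivity) (by positivity), ← Real.rpow_mul hθ0.le,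
      ← Real.rpow_mul ht0.le, div_mul_cancel₀ _ hξ0.ne', div_mul_cancel₀ _ hξ0.ne',
      Real.rpow_one, Real.rpow_neg ht0.le]
    field_simp
  rw [mul_assoc, ← hc] at hs
  have hpos : 0 < 2 / Δ * c := by positivity
  have hle : (2 / Δ * c) ^ (1 / (1 - η)) ≤ (s : ℝ) := Nat.ceil_le.mp hs
  have hs0 : (0 : ℝ) < s := (Real.rpow_pos_of_pos hpos _).trans_le hle
  have hs1 : 1 ≤ s := by exact_mod_cast hs0
  have hpow : 2 / Δ * c ≤ (s : ℝ) ^ (1 - η) := by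
    have h := Real.rpow_le_rpow (Real.rpow_nonneg hpos.le _) hle hη0.le
    rwa [← Real.rpow_mul hpos.le, div_mul_cancel₀ _ hη0.ne', Real.rpow_one] at h
  have hbonus : bonus θ ξ η α t s = c / (s : ℝ) ^ (1 - η) := by rw [bonus, hc]
  have hb : 2 * bonus θ ξ η α t s ≤ Δ := by
    rw [hbonus, mul_div_assoc', div_le_iff₀ (by positivity)]
    calc 2 * c = Δ * (2 / Δ * c) := by field_simp
      _ ≤ Δ * (s : ℝ) ^ (1 - η) := by gcongr
  have hsb : (s : ℝ) ^ η * c = s * bonus θ ξ η α t s := by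
    have h : (s : ℝ) ^ η * (s : ℝ) ^ (1 - η) = s := by
      rw [← Real.rpow_add hs0, add_sub_cancel, Real.rpow_one]
    have hne : (s : ℝ) ^ (1 - η) ≠ 0 := by positivity
    rw [hbonus, mul_div_assoc', eq_div_iff hne, mul_right_comm, h]
  rw [← hcξ]
  refine (measure_mono fun ω hω => ?_).trans (hconcL i s hs1 c hc1)
  simp only [Set.mem_ofPred_eq] at hω ⊢
  rw [hsb, ← mul_sub, ← mul_neg]
  exact mul_le_mul_of_nonneg_left (by linarith) hs0.le
end
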